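/- arXiv:2506.24007 — 3 statements merged into one kernel-verified Lean document; each statement's English description precedes it below -/
import Mathlib

section
/- Suppose the confidence event R holds (i.e., l(a) ≤ μ(a) ≤ u(a) for all a ∈ Fin K) and the candidate set S is a singleton {a}. Then a is a best arm: μ(a) = max_{b} μ(b). -/
open Finset

/-- The maximum of a real-valued function over `Fin K` when `0 < K`. -/
noncomputable def maxOf {K : ℕ} (hK : 0 < K) (f : Fin K → ℝ) : ℝ :=
  Finset.univ.sup' (Finset.univ_nonempty_iff.mpr ⟨⟨0, hK⟩⟩) f

/-- If the confidence event `R` holds and the candidate set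
`S = {a : u a ≥ max_b l b}` is a singleton `{a}`, then `a` is a best arm. -/
theorem singleton_candidate_set_is_best
    {K : ℕ} (hK : 0 < K) (μ μhat : Fin K → ℝ) (v : ℝ) (hv : 0 ≤ v)
    (l u : Fin K → ℝ)
    (hl : ∀ a, l a = μhat a - v) (hu : ∀ a, u a = μhat a + v)
    (hR : ∀ a, l a ≤ μ a ∧ μ a ≤ u a)
    (a : Fin K) (hS : {b : Fin K | u b ≥ maxOf hK l} = {a}) :
    μ a = maxOf hK μ := by
  obtain ⟨c, -, hc⟩ := Finset.exists_mem_eq_sup' (Finset.univ_nonempty_iff.mpr ⟨⟨0, hK⟩⟩) μ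
  have hmem : c ∈ {b : Fin K | u b ≥ maxOf hK l} :=
    Finset.sup'_le _ _ fun b hb =>
      (hR b).1.trans (((Finset.le_sup' μ hb).trans_eq hc).trans (hR c).2)
  rw [hS, Set.mem_singleton_iff] at hmem
  rw [← hmem]
  exact hc.symm
end

section
/- (Change-of-measure exponential lower bound.) Let 0 < ε < 1, let p satisfy ε ≤ p < 1, let q > 0 satisfy 1 − p ≤ q, and let S be a real number with S ≥ d(ε, p). Then q ≥ (1 − ε)·exp(− S/(1−ε) + (ε/(1−ε))·log ε). -/
/-- The binary relative entropy `d(x,y) = x log(x/y) + (1-x) log((1-x)/(1-y))`. -/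
noncomputable def binRelEntropy (x y : ℝ) : ℝ :=
  x * Real.log (x / y) + (1 - x) * Real.log ((1 - x) / (1 - y))

/-- Change-of-measure exponential lower bound: if `0 < ε < 1`, `ε ≤ p < 1`,
`q > 0` with `1 - p ≤ q`, and `S ≥ d(ε, p)`, then
`q ≥ (1 - ε)·exp(- S/(1-ε) + (ε/(1-ε))·log ε)`. -/
theorem change_of_measure_exponential_lower_bound
    (ε p q S : ℝ) (hε0 : 0 < ε) (hε1 : ε < 1) (hεp : ε ≤ p) (hp1 : p < 1)
    (hq : 0 < q) (hpq : 1 - p ≤ q) (hS : S ≥ binRelEntropy ε p) :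
    q ≥ (1 - ε) * Real.exp (-S / (1 - ε) + (ε / (1 - ε)) * Real.log ε) := by
  have hε : 0 < 1 - ε := sub_pos.2 hε1
  have hp : 0 < 1 - p := sub_pos.2 hp1
  have hp0 : 0 < p := hε0.trans_le hεp
  rw [binRelEntropy, Real.log_div hε0.ne' hp0.ne', Real.log_div hε.ne' hp.ne'] at hS
  have hlog : ε * Real.log p ≤ 0 :=
    mul_nonpos_of_nonneg_of_nonpos hε0.le (Real.log_nonpos hp0.le hp1.le)
  have hexp : -S / (1 - ε) + ε / (1 - ε) * Real.log ε
      ≤ Real.log (1 - p) - Real.log (1 - ε) := by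
    rw [div_mul_eq_mul_div, ← add_div, div_le_iff₀ hε]
    linarith
  calc (1 - ε) * Real.exp (-S / (1 - ε) + ε / (1 - ε) * Real.log ε)
      ≤ (1 - ε) * Real.exp (Real.log (1 - p) - Real.log (1 - ε)) := by gcongr
    _ = 1 - p := by
      rw [Real.exp_sub, Real.exp_log hp, Real.exp_log hε, mul_div_cancel₀ _ hε.ne']
    _ ≤ q := hpq
end

section
/- (Most confusing alternative for the Neyman allocation.) Let σ₁ > 0, σ₂ > 0, and μ₁, μ₂ ∈ ℝ. Set w₁ = σ₁/(σ₁+σ₂), w₂ = σ₂/(σ₁+σ₂), and m̃ = (σ₂·μ₁ + σ₁·μ₂)/(σ₁+σ₂). Then for every λ ∈ ℝ, w₁·(μ₁−λ)²/(2σ₁²) + w₂·(μ₂−λ)²/(2σ₂²) ≥ (μ₁−μ₂)²/(2(σ₁+σ₂)²), with equality if and only if λ = m̃. -/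
/-- Completing the square: the Neyman-allocation exponent at `l` is its minimum value plus a
multiple of the squared distance from `l` to the weighted midpoint. -/
theorem neyman_exponent_eq {σ₁ σ₂ : ℝ} (μ₁ μ₂ l : ℝ) (h₁ : 0 < σ₁) (h₂ : 0 < σ₂) :
    (σ₁ / (σ₁ + σ₂)) * (μ₁ - l) ^ 2 / (2 * σ₁ ^ 2)
        + (σ₂ / (σ₁ + σ₂)) * (μ₂ - l) ^ 2 / (2 * σ₂ ^ 2)
      = (μ₁ - μ₂) ^ 2 / (2 * (σ₁ + σ₂) ^ 2)
        + (l - (σ₂ * μ₁ + σ₁ * μ₂) / (σ₁ + σ₂)) ^ 2 / (2 * σ₁ * σ₂) := by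
  have hs : σ₁ + σ₂ ≠ 0 := (add_pos h₁ h₂).ne'
  field_simp
  ring

/-- Most confusing alternative for the Neyman allocation: with
`w₁ = σ₁/(σ₁+σ₂)`, `w₂ = σ₂/(σ₁+σ₂)`, and `m̃ = (σ₂μ₁ + σ₁μ₂)/(σ₁+σ₂)`,
for every `λ`,
`w₁(μ₁-λ)²/(2σ₁²) + w₂(μ₂-λ)²/(2σ₂²) ≥ (μ₁-μ₂)²/(2(σ₁+σ₂)²)`,
with equality iff `λ = m̃`. -/
theorem most_confusing_alternative (σ₁ σ₂ μ₁ μ₂ : ℝ) (h₁ : 0 < σ₁) (h₂ : 0 < σ₂) :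
    ∀ lam : ℝ,
      ((σ₁ / (σ₁ + σ₂)) * (μ₁ - lam) ^ 2 / (2 * σ₁ ^ 2)
          + (σ₂ / (σ₁ + σ₂)) * (μ₂ - lam) ^ 2 / (2 * σ₂ ^ 2)
        ≥ (μ₁ - μ₂) ^ 2 / (2 * (σ₁ + σ₂) ^ 2)) ∧
      ((σ₁ / (σ₁ + σ₂)) * (μ₁ - lam) ^ 2 / (2 * σ₁ ^ 2)
          + (σ₂ / (σ₁ + σ₂)) * (μ₂ - lam) ^ 2 / (2 * σ₂ ^ 2)
        = (μ₁ - μ₂) ^ 2 / (2 * (σ₁ + σ₂) ^ 2)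
        ↔ lam = (σ₂ * μ₁ + σ₁ * μ₂) / (σ₁ + σ₂)) := by
  intro lam
  rw [neyman_exponent_eq μ₁ μ₂ lam h₁ h₂]
  have hpos : 0 < 2 * σ₁ * σ₂ := by positivity
  refine ⟨le_add_of_nonneg_right (by positivity), ?_⟩
  rw [add_eq_left, div_eq_zero_iff, or_iff_left hpos.ne', sq_eq_zero_iff, sub_eq_zero]
end
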